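/- arXiv:math/0407115 — 8 statements merged into one kernel-verified Lean document; each statement's English description precedes it below -/
import Mathlib

section
/- For every natural number n and every x ∈ ℂ, (a^(2^n − 1)/(r₁ − r₂)) · (r₁·(x − r₂)^(2^n) − r₂·(x − r₁)^(2^n)) = a^(2^n − 1)·x^(2^n) − Σ_{k=0}^{2^n − 2} Σ_{j=0}^{⌊(2^n − k − 2)/2⌋} (−1)^j · C(2^n, k) · C(2^n − k − j − 2, j) · a^(k + j) · b^(2^n − k − 2j − 2) · c^(j + 1) · x^k, where C(m, r) denotes the binomial coefficient. (The inner sum may equivalently be taken up to 2^n − k − 2, since C(2^n − k − j − 2, j) = 0 once 2j > 2^n − k − 2.) -/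
open Finset in
/-- The sum `∑ (-1)^j C(p - j, j) b^(p - 2j) d^j` satisfies a second-order linear recurrence. -/
lemma sum_antidiagonal_choose_mul_pow_succ_succ {R : Type*} [CommRing R] (b d : R) (p : ℕ) :
    ∑ q ∈ antidiagonal (p + 2), (q.1.choose q.2 : R) * b ^ (q.1 - q.2) * (-d) ^ q.2 =
      b * ∑ q ∈ antidiagonal (p + 1), (q.1.choose q.2 : R) * b ^ (q.1 - q.2) * (-d) ^ q.2 -
        d * ∑ q ∈ antidiagonal p, (q.1.choose q.2 : R) * b ^ (q.1 - q.2) * (-d) ^ q.2 := by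
  rw [Nat.antidiagonal_succ_succ', Nat.antidiagonal_succ']
  simp only [sum_cons, sum_map, Function.Embedding.prodMap, Function.Embedding.coeFn_mk,
    Prod.map, Function.Embedding.refl_apply, mul_add, mul_sum]
  have key : ∀ q : ℕ × ℕ,
      ((q.1 + 1).choose (q.2 + 1) : R) * b ^ (q.1 + 1 - (q.2 + 1)) * (-d) ^ (q.2 + 1) =
        b * ((q.1.choose (q.2 + 1) : R) * b ^ (q.1 - (q.2 + 1)) * (-d) ^ (q.2 + 1)) -
          d * ((q.1.choose q.2 : R) * b ^ (q.1 - q.2) * (-d) ^ q.2) := by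
    rintro ⟨i, j⟩
    dsimp only
    rw [Nat.choose_succ_succ, Nat.add_sub_add_right]
    push_cast
    rcases lt_or_ge j i with h | h
    · obtain ⟨t, rfl⟩ := Nat.exists_eq_add_of_lt h
      rw [show j + t + 1 - j = t + 1 by lia, show j + t + 1 - (j + 1) = t by lia]
      ring
    · rw [Nat.choose_eq_zero_of_lt (show i < j + 1 by lia)]
      push_cast
      ring
  simp only [Nat.succ_eq_add_one, key, sum_sub_distrib]
  simp
  ring

open Finset in
lemma sub_mul_sum_antidiagonal_choose {R : Type*} [CommRing R] (u v : R) (p : ℕ) :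
    (u - v) * ∑ q ∈ antidiagonal p,
        (q.1.choose q.2 : R) * (u + v) ^ (q.1 - q.2) * (-(u * v)) ^ q.2 =
      u ^ (p + 1) - v ^ (p + 1) := by
  induction p using Nat.twoStepInduction with
  | zero => simp
  | one => simp [Nat.antidiagonal_succ]; ring
  | more p h₀ h₁ =>
    rw [sum_antidiagonal_choose_mul_pow_succ_succ]
    linear_combination (u + v) * h₁ - u * v * h₀

open Finset in
lemma sum_antidiagonal_choose_eq_sum_range {R : Type*} [CommRing R] (b d : R) (p : ℕ) :
    ∑ q ∈ antidiagonal p, (q.1.choose q.2 : R) * b ^ (q.1 - q.2) * (-d) ^ q.2 =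
      ∑ j ∈ range (p / 2 + 1),
        (-1) ^ j * ((p - j).choose j : R) * b ^ (p - 2 * j) * d ^ j := by
  rw [← Nat.sum_antidiagonal_swap]
  simp only [Prod.fst_swap, Prod.snd_swap]
  rw [Nat.sum_antidiagonal_eq_sum_range_succ
    (fun j i => (i.choose j : R) * b ^ (i - j) * (-d) ^ j)]
  symm
  refine sum_subset_zero_on_sdiff (range_mono (by lia)) ?_ ?_
  · intro j hj
    simp only [mem_sdiff, mem_range] at hj
    rw [Nat.choose_eq_zero_of_lt (by lia)]
    simp
  · intro j _
    rw [neg_pow d, show p - j - j = p - 2 * j by lia]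
    ring

open Finset in
/-- The numerator formula with an arbitrary positive exponent, cleared of denominators. -/
lemma pow_mul_sub_eq_sub_mul_sum {R : Type*} [CommRing R] (a r s x : R) (M : ℕ) :
    a ^ M * (r * (x - s) ^ (M + 1) - s * (x - r) ^ (M + 1)) =
      (r - s) * (a ^ M * x ^ (M + 1) -
        ∑ k ∈ range M, ∑ j ∈ range ((M + 1 - k - 2) / 2 + 1),
          (-1) ^ j * ((M + 1).choose k : R) * ((M + 1 - k - j - 2).choose j : R) *
            a ^ (k + j) * (-a * (r + s)) ^ (M + 1 - k - 2 * j - 2) *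
              (a * r * s) ^ (j + 1) * x ^ k) := by
  have hterm : ∀ k ∈ range M,
      (r - s) * ∑ j ∈ range ((M + 1 - k - 2) / 2 + 1),
          (-1) ^ j * ((M + 1).choose k : R) * ((M + 1 - k - j - 2).choose j : R) *
            a ^ (k + j) * (-a * (r + s)) ^ (M + 1 - k - 2 * j - 2) *
              (a * r * s) ^ (j + 1) * x ^ k =
        -(a ^ M * (r * (x ^ k * (-s) ^ (M + 1 - k) * ((M + 1).choose k : R)) -
          s * (x ^ k * (-r) ^ (M + 1 - k) * ((M + 1).choose k : R)))) := by
    intro k hk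
    obtain ⟨p, rfl⟩ := Nat.exists_eq_add_of_lt (mem_range.mp hk)
    have h := sub_mul_sum_antidiagonal_choose (-a * r) (-a * s) p
    rw [sum_antidiagonal_choose_eq_sum_range, mul_pow, mul_pow, neg_pow a] at h
    have hsum : ∑ j ∈ range ((k + p + 1 + 1 - k - 2) / 2 + 1),
          (-1) ^ j * ((k + p + 1 + 1).choose k : R) *
            ((k + p + 1 + 1 - k - j - 2).choose j : R) *
            a ^ (k + j) * (-a * (r + s)) ^ (k + p + 1 + 1 - k - 2 * j - 2) *
              (a * r * s) ^ (j + 1) * x ^ k =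
        ((k + p + 1 + 1).choose k : R) * a ^ k * (a * r * s) * x ^ k *
          ∑ j ∈ range (p / 2 + 1), (-1) ^ j * ((p - j).choose j : R) *
            (-a * r + -a * s) ^ (p - 2 * j) * (-a * r * (-a * s)) ^ j := by
      rw [mul_sum, show k + p + 1 + 1 - k - 2 = p by lia]
      refine sum_congr rfl fun j _ => ?_
      rw [show k + p + 1 + 1 - k - j - 2 = p - j by lia,
        show k + p + 1 + 1 - k - 2 * j - 2 = p - 2 * j by lia,
        show -a * r + -a * s = -a * (r + s) by ring,
        show -a * r * (-a * s) = a * (a * r * s) by ring, mul_pow a (a * r * s)]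
      ring
    rw [hsum, show k + p + 1 + 1 - k = p + 2 by lia, neg_pow r, neg_pow s]
    linear_combination
      -((k + p + 1 + 1).choose k : R) * a ^ k * (r * s) * x ^ k * h
  rw [mul_sub (r - s), mul_sum _ _ (r - s), sum_congr rfl hterm, sub_eq_add_neg x s,
    sub_eq_add_neg x r, add_pow,
    add_pow, sum_range_succ, sum_range_succ, sum_range_succ _ (M + 1), sum_range_succ _ M]
  simp only [sum_neg_distrib, ← mul_sum, sum_sub_distrib]
  simp
  ring


/-- Explicit formula for the numerator `Pₙ` of the `n`-th symbolic Newton iterate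
for the quadratic `f(x) = a x² + b x + c` with distinct roots `r₁, r₂`. -/
theorem newton_numerator_explicit
    (a b c r₁ r₂ : ℂ) (ha : a ≠ 0) (hdisc : b ^ 2 - 4 * a * c ≠ 0)
    (hroots : ∀ X : ℂ, a * X ^ 2 + b * X + c = a * (X - r₁) * (X - r₂))
    (hr : r₁ ≠ r₂) :
    ∀ (n : ℕ) (x : ℂ),
      (a ^ (2 ^ n - 1) / (r₁ - r₂)) *
          (r₁ * (x - r₂) ^ (2 ^ n) - r₂ * (x - r₁) ^ (2 ^ n)) =
        a ^ (2 ^ n - 1) * x ^ (2 ^ n) -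
          ∑ k ∈ Finset.range (2 ^ n - 1),
            ∑ j ∈ Finset.range ((2 ^ n - k - 2) / 2 + 1),
              (-1 : ℂ) ^ j * ((2 ^ n).choose k : ℂ) *
                ((2 ^ n - k - j - 2).choose j : ℂ) *
                a ^ (k + j) * b ^ (2 ^ n - k - 2 * j - 2) * c ^ (j + 1) * x ^ k := by
  intro n x
  obtain ⟨M, hM⟩ : ∃ M, 2 ^ n = M + 1 := Nat.exists_eq_succ_of_ne_zero (by positivity)
  have h₀ := hroots 0
  have h₁ := hroots 1
  have hc : c = a * r₁ * r₂ := by linear_combination h₀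
  have hb : b = -a * (r₁ + r₂) := by linear_combination h₁ - h₀
  rw [hM, Nat.add_sub_cancel, div_mul_eq_mul_div, div_eq_iff (sub_ne_zero.mpr hr), hb, hc,
    pow_mul_sub_eq_sub_mul_sum, mul_comm]
end

section
/- For every natural number n and every x ∈ ℂ, (a^(2^n − 1)/(r₁ − r₂)) · ((x − r₂)^(2^n) − (x − r₁)^(2^n)) = Σ_{k=0}^{2^n − 1} Σ_{j=0}^{⌊(2^n − k − 1)/2⌋} (−1)^j · C(2^n, k) · C(2^n − k − j − 1, j) · a^(k + j) · b^(2^n − k − 2j − 1) · c^j · x^k, where C(m, r) denotes the binomial coefficient. (The inner sum may equivalently be taken up to 2^n − k − 1, since C(2^n − k − j − 1, j) = 0 once 2j > 2^n − k − 1.) -/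
open Finset in
/-- `(s ^ (m + 1) - t ^ (m + 1)) / (s - t)` as a polynomial in `s + t` and `s * t`. -/
theorem sub_mul_sum_choose_eq_pow_sub_pow {R : Type*} [CommRing R] (s t : R) (m M : ℕ)
    (hM : m / 2 < M) :
    (s - t) * ∑ j ∈ range M,
        (-1) ^ j * ((m - j).choose j : R) * (s + t) ^ (m - 2 * j) * (s * t) ^ j =
      s ^ (m + 1) - t ^ (m + 1) := by
  induction m using Nat.twoStepInduction generalizing M with
  | zero =>
    obtain ⟨M, rfl⟩ := Nat.exists_eq_add_one_of_ne_zero (by omega : M ≠ 0)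
    simp [sum_range_succ']
  | one =>
    obtain ⟨M, rfl⟩ := Nat.exists_eq_add_one_of_ne_zero (by omega : M ≠ 0)
    have h (j : ℕ) : (1 - (j + 1)).choose (j + 1) = 0 := Nat.choose_eq_zero_of_lt (by omega)
    simp only [sum_range_succ', h]
    simp
    ring
  | more m ih₀ ih₁ =>
    obtain ⟨M, rfl⟩ := Nat.exists_eq_add_one_of_ne_zero (by omega : M ≠ 0)
    have h₀ := ih₀ M (by omega)
    have h₁ := ih₁ (M + 1) (by omega)
    have step (j : ℕ) :
        (-1) ^ (j + 1) * ((m + 2 - (j + 1)).choose (j + 1) : R) *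
            (s + t) ^ (m + 2 - 2 * (j + 1)) * (s * t) ^ (j + 1) =
          (s + t) * ((-1) ^ (j + 1) * ((m + 1 - (j + 1)).choose (j + 1) : R) *
            (s + t) ^ (m + 1 - 2 * (j + 1)) * (s * t) ^ (j + 1)) -
          s * t * ((-1) ^ j * ((m - j).choose j : R) * (s + t) ^ (m - 2 * j) * (s * t) ^ j) := by
      rw [show m + 2 - 2 * (j + 1) = m - 2 * j by omega,
        show m + 1 - (j + 1) = m - j by omega]
      have pascal :
          (m + 2 - (j + 1)).choose (j + 1) = (m - j).choose j + (m - j).choose (j + 1) := by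
        rcases le_or_gt j m with hj | hj
        · rw [show m + 2 - (j + 1) = m - j + 1 by omega, Nat.choose_succ_succ]
        · rw [Nat.choose_eq_zero_of_lt (by omega), Nat.choose_eq_zero_of_lt (by omega),
            Nat.choose_eq_zero_of_lt (by omega)]
      rw [pascal]
      rcases le_or_gt (2 * j + 1) m with hj | hj
      · rw [show m - 2 * j = m + 1 - 2 * (j + 1) + 1 by omega]
        push_cast
        ring
      · rw [Nat.choose_eq_zero_of_lt (by omega : m - j < j + 1)]
        push_cast
        ring
    rw [sum_range_succ'] at h₁ ⊢
    simp only [step, sum_sub_distrib, ← mul_sum]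
    simp only [pow_zero, Nat.sub_zero, Nat.choose_zero_right, Nat.cast_one, mul_zero, mul_one,
      one_mul] at h₁ ⊢
    linear_combination (s + t) * h₁ - s * t * h₀

/-- Explicit formula for the denominator `Qₙ` of the `n`-th symbolic Newton iterate
for the quadratic `f(x) = a x² + b x + c` with distinct roots `r₁, r₂`. -/
theorem newton_denominator_explicit
    (a b c r₁ r₂ : ℂ) (ha : a ≠ 0) (hdisc : b ^ 2 - 4 * a * c ≠ 0)
    (hroots : ∀ X : ℂ, a * X ^ 2 + b * X + c = a * (X - r₁) * (X - r₂))
    (hr : r₁ ≠ r₂) :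
    ∀ (n : ℕ) (x : ℂ),
      (a ^ (2 ^ n - 1) / (r₁ - r₂)) *
          ((x - r₂) ^ (2 ^ n) - (x - r₁) ^ (2 ^ n)) =
        ∑ k ∈ Finset.range (2 ^ n),
          ∑ j ∈ Finset.range ((2 ^ n - k - 1) / 2 + 1),
            (-1 : ℂ) ^ j * ((2 ^ n).choose k : ℂ) *
              ((2 ^ n - k - j - 1).choose j : ℂ) *
              a ^ (k + j) * b ^ (2 ^ n - k - 2 * j - 1) * c ^ j * x ^ k := by
  intro n x
  have h0 := hroots 0
  have h1 := hroots 1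
  have hsum : -a * r₂ + -a * r₁ = b := by linear_combination h0 - h1
  have hprod : (-a * r₂) * (-a * r₁) = a * c := by linear_combination -a * h0
  have hr' : r₁ - r₂ ≠ 0 := sub_ne_zero.mpr hr
  generalize 2 ^ n = N
  rw [sub_eq_add_neg x r₂, sub_eq_add_neg x r₁, add_pow, add_pow, ← Finset.sum_sub_distrib,
    Finset.sum_range_succ, Nat.sub_self, pow_zero, pow_zero, sub_self, add_zero, Finset.mul_sum]
  refine Finset.sum_congr rfl fun k hk => ?_
  obtain ⟨m, rfl⟩ : ∃ m, N = k + m + 1 :=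
    ⟨N - k - 1, by have := Finset.mem_range.mp hk; omega⟩
  have key := sub_mul_sum_choose_eq_pow_sub_pow (-a * r₂) (-a * r₁) m (m / 2 + 1) (by omega)
  rw [hsum, hprod] at key
  have hterm : ∑ j ∈ Finset.range ((k + m + 1 - k - 1) / 2 + 1),
      (-1 : ℂ) ^ j * ((k + m + 1).choose k : ℂ) *
        ((k + m + 1 - k - j - 1).choose j : ℂ) *
        a ^ (k + j) * b ^ (k + m + 1 - k - 2 * j - 1) * c ^ j * x ^ k =
      ((k + m + 1).choose k : ℂ) * a ^ k * x ^ k * ∑ j ∈ Finset.range (m / 2 + 1),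
        (-1) ^ j * ((m - j).choose j : ℂ) * b ^ (m - 2 * j) * (a * c) ^ j := by
    rw [Finset.mul_sum, show k + m + 1 - k - 1 = m by omega]
    refine Finset.sum_congr rfl fun j _ => ?_
    rw [show k + m + 1 - k - j - 1 = m - j by omega,
      show k + m + 1 - k - 2 * j - 1 = m - 2 * j by omega]
    ring
  rw [hterm, show k + m + 1 - k = m + 1 by omega, show k + m + 1 - 1 = k + m by omega]
  rw [show -a * r₂ = a * -r₂ by ring, show -a * r₁ = a * -r₁ by ring, mul_pow, mul_pow] at key
  rw [div_mul_eq_mul_div, div_eq_iff hr']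
  refine mul_left_cancel₀ ha ?_
  linear_combination -((k + m + 1).choose k : ℂ) * a ^ k * x ^ k * key
end

section
/- Define, for elements x, y of a commutative ring and n ≥ 1, T(n) = (x − y) · Σ_{i=0}^{⌊(n−1)/2⌋} (−1)^i · C(n − i − 1, i) · (x + y)^(n − 2i − 1) · (xy)^i. Then for every n ≥ 2, T(n + 1) = (x + y)·T(n) − xy·T(n − 1). -/
/-- The `i`-th term of the Fibonacci-type polynomial of degree `m` in `s` and `p`. -/
def signedChooseTerm {R : Type*} [CommRing R] (s p : R) (m i : ℕ) : R :=
  (-1 : R) ^ i * ((m - i).choose i : R) * s ^ (m - 2 * i) * p ^ i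

theorem signedChooseTerm_eq_zero {R : Type*} [CommRing R] (s p : R) {m i : ℕ}
    (h : m < 2 * i) : signedChooseTerm s p m i = 0 := by
  simp [signedChooseTerm, Nat.choose_eq_zero_of_lt (show m - i < i by omega)]

theorem signedChooseTerm_succ {R : Type*} [CommRing R] (s p : R) (m i : ℕ) :
    signedChooseTerm s p (m + 2) (i + 1) =
      s * signedChooseTerm s p (m + 1) (i + 1) - p * signedChooseTerm s p m i := by
  rcases lt_trichotomy m (2 * i) with h | rfl | h
  · rw [signedChooseTerm_eq_zero s p (show m + 2 < 2 * (i + 1) by omega),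
      signedChooseTerm_eq_zero s p (show m + 1 < 2 * (i + 1) by omega),
      signedChooseTerm_eq_zero s p h]
    ring
  · rw [signedChooseTerm_eq_zero s p (show 2 * i + 1 < 2 * (i + 1) by omega)]
    simp only [signedChooseTerm, show 2 * i + 2 - (i + 1) = i + 1 by omega,
      show 2 * i - i = i by omega, show 2 * i + 2 - 2 * (i + 1) = 0 by omega,
      Nat.sub_self, Nat.choose_self]
    ring
  · obtain ⟨k, rfl⟩ := Nat.exists_eq_add_of_lt h
    simp only [signedChooseTerm, show 2 * i + k + 1 + 2 - (i + 1) = (i + k + 1) + 1 by omega,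
      show 2 * i + k + 1 + 1 - (i + 1) = i + k + 1 by omega,
      show 2 * i + k + 1 - i = i + k + 1 by omega,
      show 2 * i + k + 1 + 2 - 2 * (i + 1) = k + 1 by omega,
      show 2 * i + k + 1 + 1 - 2 * (i + 1) = k by omega,
      show 2 * i + k + 1 - 2 * i = k + 1 by omega, Nat.choose_succ_succ' (i + k + 1) i]
    push_cast
    ring

theorem sum_signedChooseTerm_eq {R : Type*} [CommRing R] (s p : R) {m N : ℕ}
    (h : m / 2 + 1 ≤ N) :
    ∑ i ∈ Finset.range (m / 2 + 1), signedChooseTerm s p m i =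
      ∑ i ∈ Finset.range N, signedChooseTerm s p m i := by
  refine Finset.sum_subset (Finset.range_subset_range.2 h) fun i _ hi => ?_
  rw [Finset.mem_range] at hi
  exact signedChooseTerm_eq_zero s p (by omega)

theorem sum_signedChooseTerm_add_two {R : Type*} [CommRing R] (s p : R) (m : ℕ) :
    ∑ i ∈ Finset.range ((m + 2) / 2 + 1), signedChooseTerm s p (m + 2) i =
      s * ∑ i ∈ Finset.range ((m + 1) / 2 + 1), signedChooseTerm s p (m + 1) i -
        p * ∑ i ∈ Finset.range (m / 2 + 1), signedChooseTerm s p m i := by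
  rw [sum_signedChooseTerm_eq s p (show (m + 1) / 2 + 1 ≤ (m / 2 + 1) + 1 by omega),
    show (m + 2) / 2 = m / 2 + 1 by omega, Finset.sum_range_succ' _ (m / 2 + 1),
    Finset.sum_range_succ' _ (m / 2 + 1)]
  simp only [signedChooseTerm_succ, Finset.sum_sub_distrib, ← Finset.mul_sum]
  simp only [signedChooseTerm, Nat.choose_zero_right, Nat.mul_zero, Nat.sub_zero]
  ring

/-- The three-term recurrence `T(n+1) = (x+y)·T(n) - xy·T(n-1)` for the
right-hand side of the identity in Lemma 1 of the paper. -/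
theorem binomial_identity_recurrence {R : Type*} [CommRing R] (x y : R)
    (T : ℕ → R)
    (hT : ∀ n : ℕ, 1 ≤ n →
      T n =
        (x - y) *
          ∑ i ∈ Finset.range ((n - 1) / 2 + 1),
            (-1 : R) ^ i * ((n - i - 1).choose i : R) *
              (x + y) ^ (n - 2 * i - 1) * (x * y) ^ i) :
    ∀ n : ℕ, 2 ≤ n → T (n + 1) = (x + y) * T n - x * y * T (n - 1) := by
  intro n hn
  obtain ⟨m, rfl⟩ := Nat.exists_eq_add_of_le' hn
  have key : ∀ k : ℕ, T (k + 1) = (x - y) *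
      ∑ i ∈ Finset.range (k / 2 + 1), signedChooseTerm (x + y) (x * y) k i := by
    intro k
    rw [hT (k + 1) (by omega), Nat.add_sub_cancel]
    simp only [signedChooseTerm, Nat.sub_right_comm (k + 1) _ 1, Nat.add_sub_cancel]
  rw [show m + 2 - 1 = m + 1 by omega, key (m + 2), key (m + 1), key m,
    sum_signedChooseTerm_add_two]
  ring
end

section
/- Let a, b, c ∈ ℂ with a ≠ 0 and b² − 4ac ≠ 0. Define polynomials P_n, Q_n ∈ ℂ[X] recursively by P₀ = X, Q₀ = 1, P_{n+1} = a·P_n² − c·Q_n², and Q_{n+1} = 2a·P_n·Q_n + b·Q_n². Then for every natural number n, the polynomials P_n and Q_n are coprime in ℂ[X] (i.e., they have no common non-unit polynomial factor). -/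
open Polynomial

/-- If `a` and `b ^ 2 - 4 * a * c` are units, then the step sending `p / q` to its Newton iterate
for the quadratic with coefficients `a`, `b`, `c` preserves coprimality. -/
theorem IsCoprime.newton_quadratic_step {R : Type*} [CommRing R] {a b c p q : R}
    (ha : IsUnit a) (hdisc : IsUnit (b ^ 2 - 4 * a * c)) (h : IsCoprime p q) :
    IsCoprime (a * p ^ 2 - c * q ^ 2) (2 * a * p * q + b * q ^ 2) := by
  have hq : IsCoprime (a * p ^ 2 - c * q ^ 2) q := by
    have hap : IsCoprime (a * p ^ 2) q :=
      (isCoprime_mul_unit_left_left ha _ _).2 h.pow_left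
    convert hap.add_mul_left_left (-(c * q)) using 1
    ring
  have hlin : IsCoprime (a * p ^ 2 - c * q ^ 2) (2 * a * p + b * q) := by
    obtain ⟨s, t, hst⟩ : IsCoprime (p ^ 2) (q ^ 2) := h.pow
    obtain ⟨v, hv⟩ := (ha.mul hdisc).exists_left_inv
    refine ⟨v * (s * b ^ 2 + 4 * a ^ 2 * t),
      v * (s * c * (b * q - 2 * a * p) - a * t * (2 * a * p - b * q)), ?_⟩
    linear_combination v * (a * (b ^ 2 - 4 * a * c)) * hst + hv
  convert hq.mul_right hlin using 1
  ring

/-- The recursively defined numerators and denominators of the Newton iterates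
of a quadratic with nonzero discriminant are coprime in `ℂ[X]`. -/
theorem newton_recursive_polynomials_coprime
    (a b c : ℂ) (ha : a ≠ 0) (hdisc : b ^ 2 - 4 * a * c ≠ 0)
    (P Q : ℕ → Polynomial ℂ)
    (hP0 : P 0 = Polynomial.X) (hQ0 : Q 0 = 1)
    (hP : ∀ n : ℕ, P (n + 1) = Polynomial.C a * (P n) ^ 2 - Polynomial.C c * (Q n) ^ 2)
    (hQ : ∀ n : ℕ, Q (n + 1) =
      2 * Polynomial.C a * P n * Q n + Polynomial.C b * (Q n) ^ 2) :
    ∀ n : ℕ, IsCoprime (P n) (Q n) := by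
  intro n
  induction n with
  | zero => exact hQ0 ▸ isCoprime_one_right
  | succ n ih =>
    rw [hP, hQ]
    refine ih.newton_quadratic_step (isUnit_C.2 ha.isUnit) ?_
    have hD := isUnit_C.2 hdisc.isUnit
    simpa only [C_sub, C_mul, C_pow, C_ofNat] using hD
end

section
/- For every z ∈ ℂ with 2az + b ≠ 0, setting N(z) = z − (az² + bz + c)/(2az + b), one has (N(z) − r₁)·(z − r₂)² = (N(z) − r₂)·(z − r₁)². In particular, whenever additionally z ≠ r₂ and N(z) ≠ r₂, this says φ(N(z)) = φ(z)² for the fractional linear transformation φ(τ) = (τ − r₁)/(τ − r₂): Newton's method for the quadratic f is conjugate to the squaring map. -/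
/-- One step of Newton's method for a quadratic is conjugate to squaring:
`(N(z) - r₁)·(z - r₂)² = (N(z) - r₂)·(z - r₁)²`. -/
theorem newton_step_conjugate_to_squaring
    (a b c r₁ r₂ : ℂ) (ha : a ≠ 0) (hdisc : b ^ 2 - 4 * a * c ≠ 0)
    (hroots : ∀ X : ℂ, a * X ^ 2 + b * X + c = a * (X - r₁) * (X - r₂))
    (hr : r₁ ≠ r₂)
    (z : ℂ) (hz : 2 * a * z + b ≠ 0) :
    ((z - (a * z ^ 2 + b * z + c) / (2 * a * z + b)) - r₁) * (z - r₂) ^ 2 =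
      ((z - (a * z ^ 2 + b * z + c) / (2 * a * z + b)) - r₂) * (z - r₁) ^ 2 := by
  have hb : b = -a * (r₁ + r₂) := by
    linear_combination (hroots 1 - hroots (-1)) / 2
  have h₁ : z - (a * z ^ 2 + b * z + c) / (2 * a * z + b) - r₁ =
      a * (z - r₁) ^ 2 / (2 * a * z + b) := by
    rw [hroots z, eq_div_iff hz, sub_mul, sub_mul, div_mul_cancel₀ _ hz, hb]
    ring
  have h₂ : z - (a * z ^ 2 + b * z + c) / (2 * a * z + b) - r₂ =
      a * (z - r₂) ^ 2 / (2 * a * z + b) := by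
    rw [hroots z, eq_div_iff hz, sub_mul, sub_mul, div_mul_cancel₀ _ hz, hb]
    ring
  rw [h₁, h₂]
  ring
end

section
/- Let N(z) = z − (az² + bz + c)/(2az + b) be the Newton map of f, and let n be a natural number. If z ∈ ℂ is such that 2a·N^[m](z) + b ≠ 0 for every m < n (where N^[m] denotes the m-fold iterate of N), then (N^[n](z) − r₁)·(z − r₂)^(2^n) = (N^[n](z) − r₂)·(z − r₁)^(2^n). -/
/-- A Newton step for a polynomial with value `a * (w - r) * (w - s)` and derivative
`a * (2 * w - r - s)` at `w` squares the distance to the root `r`, up to a factor symmetric in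
the two roots. -/
theorem newton_step_sub_root {K : Type*} [Field K] {a r s w p d : K}
    (hp : p = a * (w - r) * (w - s)) (hd : d = a * (2 * w - r - s)) (hd0 : d ≠ 0) :
    w - p / d - r = a / d * (w - r) ^ 2 := by
  field_simp
  rw [hp, hd]
  ring

/-- The `n`-fold Newton iterate for a quadratic is conjugate to `z ↦ z^(2ⁿ)`:
`(Nⁿ(z) - r₁)·(z - r₂)^(2ⁿ) = (Nⁿ(z) - r₂)·(z - r₁)^(2ⁿ)`. -/
theorem newton_iterate_conjugate_to_power
    (a b c r₁ r₂ : ℂ) (ha : a ≠ 0) (hdisc : b ^ 2 - 4 * a * c ≠ 0)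
    (hroots : ∀ X : ℂ, a * X ^ 2 + b * X + c = a * (X - r₁) * (X - r₂))
    (hr : r₁ ≠ r₂)
    (N : ℂ → ℂ)
    (hN : ∀ z : ℂ, N z = z - (a * z ^ 2 + b * z + c) / (2 * a * z + b))
    (n : ℕ) (z : ℂ)
    (hz : ∀ m : ℕ, m < n → 2 * a * (N^[m] z) + b ≠ 0) :
    (N^[n] z - r₁) * (z - r₂) ^ (2 ^ n) =
      (N^[n] z - r₂) * (z - r₁) ^ (2 ^ n) := by
  have hc : c = a * r₁ * r₂ := by linear_combination hroots 0
  have hb : b = -a * (r₁ + r₂) := by linear_combination hroots 1 - hc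
  induction n with
  | zero => simp only [Function.iterate_zero, id_eq, pow_zero, pow_one]; ring
  | succ n ih =>
    have h := ih fun m hm => hz m (hm.trans n.lt_succ_self)
    have hd0 := hz n n.lt_succ_self
    rw [Function.iterate_succ_apply']
    generalize N^[n] z = w at h hd0 ⊢
    have h₁ : N w - r₁ = a / (2 * a * w + b) * (w - r₁) ^ 2 :=
      hN w ▸ newton_step_sub_root (hroots w) (by rw [hb]; ring) hd0
    have h₂ : N w - r₂ = a / (2 * a * w + b) * (w - r₂) ^ 2 :=
      hN w ▸ newton_step_sub_root (s := r₁) (by rw [hroots w]; ring) (by rw [hb]; ring) hd0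
    rw [h₁, h₂, pow_succ 2 n, pow_mul, pow_mul, mul_assoc (a / _),
      mul_assoc (a / _), ← mul_pow, ← mul_pow, h]
end

section
/- Define, for each natural number n and x ∈ ℂ, P_n(x) = (a^(2^n − 1)/(r₁ − r₂))·(r₁(x − r₂)^(2^n) − r₂(x − r₁)^(2^n)) and Q_n(x) = (a^(2^n − 1)/(r₁ − r₂))·((x − r₂)^(2^n) − (x − r₁)^(2^n)). Then P₀(x) = x, Q₀(x) = 1, and for every n and every x ∈ ℂ, P_{n+1}(x) = a·P_n(x)² − c·Q_n(x)² and Q_{n+1}(x) = 2a·P_n(x)·Q_n(x) + b·Q_n(x)². -/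
/-- The closed-form numerators and denominators of the Newton iterates of a
quadratic satisfy the natural Newton recursion. -/
theorem newton_closed_form_satisfies_recursion
    (a b c r₁ r₂ : ℂ) (ha : a ≠ 0) (hdisc : b ^ 2 - 4 * a * c ≠ 0)
    (hroots : ∀ X : ℂ, a * X ^ 2 + b * X + c = a * (X - r₁) * (X - r₂))
    (hr : r₁ ≠ r₂)
    (P Q : ℕ → ℂ → ℂ)
    (hP : ∀ (n : ℕ) (x : ℂ), P n x =
      (a ^ (2 ^ n - 1) / (r₁ - r₂)) *
        (r₁ * (x - r₂) ^ (2 ^ n) - r₂ * (x - r₁) ^ (2 ^ n)))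
    (hQ : ∀ (n : ℕ) (x : ℂ), Q n x =
      (a ^ (2 ^ n - 1) / (r₁ - r₂)) *
        ((x - r₂) ^ (2 ^ n) - (x - r₁) ^ (2 ^ n))) :
    (∀ x : ℂ, P 0 x = x) ∧ (∀ x : ℂ, Q 0 x = 1) ∧
      (∀ (n : ℕ) (x : ℂ), P (n + 1) x = a * (P n x) ^ 2 - c * (Q n x) ^ 2) ∧
      (∀ (n : ℕ) (x : ℂ), Q (n + 1) x = 2 * a * P n x * Q n x + b * (Q n x) ^ 2) := by
  have hc : c = a * r₁ * r₂ := by linear_combination hroots 0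
  have hb : b = -a * (r₁ + r₂) := by
    linear_combination (hroots 1 - hroots (-1)) / 2
  have hd : r₁ - r₂ ≠ 0 := sub_ne_zero.mpr hr
  have ha_pow (n : ℕ) : a ^ (2 ^ (n + 1) - 1) = a * (a ^ (2 ^ n - 1)) ^ 2 := by
    rw [← pow_mul, ← pow_succ']
    congr 1
    have := Nat.one_le_two_pow (n := n)
    omega
  have hsq (n : ℕ) (y : ℂ) : y ^ 2 ^ (n + 1) = (y ^ 2 ^ n) ^ 2 := by
    rw [pow_succ 2 n, pow_mul]
  refine ⟨fun x => ?_, fun x => ?_, fun n x => ?_, fun n x => ?_⟩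
  · rw [hP]
    simp only [pow_zero, Nat.sub_self, pow_one]
    field_simp
    ring
  · rw [hQ]
    simp only [pow_zero, Nat.sub_self, pow_one]
    field_simp
    ring
  · rw [hP, hP, hQ, ha_pow, hsq, hsq, hc]
    generalize (x - r₂) ^ 2 ^ n = u, (x - r₁) ^ 2 ^ n = v, a ^ (2 ^ n - 1) = k
    field_simp
    ring
  · rw [hQ, hP, hQ, ha_pow, hsq, hsq, hb]
    generalize (x - r₂) ^ 2 ^ n = u, (x - r₁) ^ 2 ^ n = v, a ^ (2 ^ n - 1) = k
    field_simp
    ring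
end

section
/- For every natural number n, the polynomials P_n = (a^(2^n − 1)/(r₁ − r₂))·(r₁(X − r₂)^(2^n) − r₂(X − r₁)^(2^n)) and Q_n = (a^(2^n − 1)/(r₁ − r₂))·((X − r₂)^(2^n) − (X − r₁)^(2^n)) are coprime in ℂ[X]. -/
open Polynomial

/-- An invertible linear substitution, given by its matrix `k • !![r, -s; 1, -1]`, preserves
coprimality. -/
theorem IsCoprime.mul_linear_combinations {R : Type*} [CommRing R] {p q k r s d : R}
    (h : IsCoprime p q) (hd : d * (k * (r - s)) = 1) :
    IsCoprime (k * (r * p - s * q)) (k * (p - q)) := by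
  obtain ⟨u, v, huv⟩ := h
  refine ⟨d * (u + v), -(d * (u * s + v * r)), ?_⟩
  linear_combination (u * p + v * q) * hd + huv

/-- The closed-form numerator and denominator polynomials of the `n`-th Newton
iterate of a quadratic are coprime in `ℂ[X]`. -/
theorem newton_closed_form_polynomials_coprime
    (a b c r₁ r₂ : ℂ) (ha : a ≠ 0) (hdisc : b ^ 2 - 4 * a * c ≠ 0)
    (hroots : ∀ X : ℂ, a * X ^ 2 + b * X + c = a * (X - r₁) * (X - r₂))
    (hr : r₁ ≠ r₂) (n : ℕ) :
    IsCoprime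
      (Polynomial.C (a ^ (2 ^ n - 1) / (r₁ - r₂)) *
        (Polynomial.C r₁ * (Polynomial.X - Polynomial.C r₂) ^ (2 ^ n) -
          Polynomial.C r₂ * (Polynomial.X - Polynomial.C r₁) ^ (2 ^ n)))
      (Polynomial.C (a ^ (2 ^ n - 1) / (r₁ - r₂)) *
        ((Polynomial.X - Polynomial.C r₂) ^ (2 ^ n) -
          (Polynomial.X - Polynomial.C r₁) ^ (2 ^ n))) := by
  have hsub : r₁ - r₂ ≠ 0 := sub_ne_zero.mpr hr
  have hcop : IsCoprime ((X - C r₂) ^ 2 ^ n : ℂ[X]) ((X - C r₁) ^ 2 ^ n) :=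
    (isCoprime_X_sub_C_of_isUnit_sub (sub_ne_zero.mpr hr.symm).isUnit).pow
  refine hcop.mul_linear_combinations (d := C (a ^ (2 ^ n - 1))⁻¹) ?_
  rw [← C_sub, ← C_mul, ← C_mul, div_mul_cancel₀ _ hsub, inv_mul_cancel₀ (pow_ne_zero _ ha), C_1]
end
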